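/- Let w = w_t be the work function at time t ≥ 1 of a 3-server instance on the circle of circumference 2Δ with last request r = r_t, let u be a circle point, and let (x,y,z) ∈ P. Suppose w({u,x,ȳ}) resolves from x, both w({u,y,z̄}) and w({u,z,x̄}) resolve from u, and r lies on the arc between ȳ and z̄ not containing x̄ (i.e., d(ȳ,r) + d(r,z̄) = d(ȳ,z̄)). Then there exists a triple (x',y',z') ∈ P such that Φ*(w, u, x, y, z) ≥ Φ*(w, r, x', y', z'). -/

import Mathlib

open Finset

/-- Minimum-matching (Wasserstein) distance between two `k`-point configurations,
represented as `k`-tuples of points. -/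
noncomputable def confDist {Ω : Type*} [MetricSpace Ω] {k : ℕ} (X Y : Fin k → Ω) : ℝ :=
  ⨅ σ : Equiv.Perm (Fin k), ∑ i, dist (X i) (Y (σ i))

/-- The work function at time `t` of the `k`-server instance with initial configuration
`X₀` and requests `r 1, r 2, …` (the value `r 0` is unused): the least cost of serving
the first `t` requests and then moving to the configuration `X`. -/
noncomputable def workFn {Ω : Type*} [MetricSpace Ω] (k : ℕ) (X₀ : Fin k → Ω)
    (r : ℕ → Ω) (t : ℕ) (X : Fin k → Ω) : ℝ :=
  sInf { c : ℝ | ∃ Y : ℕ → Fin k → Ω, Y 0 = X₀ ∧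
    (∀ i ∈ Finset.Icc 1 t, ∃ j, Y i j = r i) ∧
    c = (∑ i ∈ Finset.Icc 1 t, confDist (Y (i - 1)) (Y i)) + confDist (Y t) X }

/-- The offline optimum of the `k`-server instance with initial configuration `X₀`
and requests `r 1, …, r T`. -/
noncomputable def opt {Ω : Type*} [MetricSpace Ω] (k : ℕ) (X₀ : Fin k → Ω)
    (r : ℕ → Ω) (T : ℕ) : ℝ :=
  sInf { c : ℝ | ∃ Y : ℕ → Fin k → Ω, Y 0 = X₀ ∧
    (∀ i ∈ Finset.Icc 1 T, ∃ j, Y i j = r i) ∧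
    c = ∑ i ∈ Finset.Icc 1 T, confDist (Y (i - 1)) (Y i) }

/-- `OPT_t(Z)`: the least cost of serving the first `t` requests while ending
in the configuration `Z`. -/
noncomputable def optTo {Ω : Type*} [MetricSpace Ω] (k : ℕ) (X₀ : Fin k → Ω)
    (r : ℕ → Ω) (t : ℕ) (Z : Fin k → Ω) : ℝ :=
  sInf { c : ℝ | ∃ Y : ℕ → Fin k → Ω, Y 0 = X₀ ∧
    (∀ i ∈ Finset.Icc 1 t, ∃ j, Y i j = r i) ∧ Y t = Z ∧
    c = ∑ i ∈ Finset.Icc 1 t, confDist (Y (i - 1)) (Y i) }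

/-- `X 0, X 1, …, X T` is a run of the work function algorithm on the `k`-server
instance with initial configuration `X₀` and requests `r 1, …, r T`. -/
def IsWFARun {Ω : Type*} [MetricSpace Ω] (k : ℕ) (X₀ : Fin k → Ω)
    (r : ℕ → Ω) (T : ℕ) (X : ℕ → Fin k → Ω) : Prop :=
  X 0 = X₀ ∧ ∀ t, 1 ≤ t → t ≤ T →
    (∃ j, X t j = r t) ∧
    ∀ Z : Fin k → Ω, (∃ j, Z j = r t) →
      optTo k X₀ r t (X t) + confDist (X t) (X (t - 1)) ≤
        optTo k X₀ r t Z + confDist Z (X (t - 1))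
/-- The antipode `x̄ = x + Δ` of a point on the circle of circumference `2Δ`. -/
noncomputable def antip (Δ : ℝ) (x : AddCircle (2*Δ)) : AddCircle (2*Δ) := x + (Δ : ℝ)

/-- The set `P`: triples of circle points not contained in any open semicircle,
i.e. with `d(x,y) + d(y,z) + d(z,x) = 2Δ`. -/
def InP (Δ : ℝ) (x y z : AddCircle (2*Δ)) : Prop :=
  dist x y + dist y z + dist z x = 2*Δ

/-- The potential `Φ*(w,u,x,y,z) = w(ū³) + w(u x ȳ) + w(u y z̄) + w(u z x̄)`. -/
noncomputable def PhiStar (Δ : ℝ) (w : (Fin 3 → AddCircle (2*Δ)) → ℝ)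
    (u x y z : AddCircle (2*Δ)) : ℝ :=
  w ![antip Δ u, antip Δ u, antip Δ u] + w ![u, x, antip Δ y]
    + w ![u, y, antip Δ z] + w ![u, z, antip Δ x]

/-- `w(X)` resolves from the `i`-th point of the configuration `X` (w.r.t. the
last request `r`): `w(X) = w(X - X i + r) + d(X i, r)`. -/
def ResolvesFrom {Ω : Type*} [MetricSpace Ω] (w : (Fin 3 → Ω) → ℝ) (r : Ω)
    (X : Fin 3 → Ω) (i : Fin 3) : Prop :=
  w X = w (Function.update X i r) + dist (X i) r

section Matching

variable {Ω : Type*} [MetricSpace Ω] {k : ℕ}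

theorem confDist_le (X Y : Fin k → Ω) (σ : Equiv.Perm (Fin k)) :
    confDist X Y ≤ ∑ i, dist (X i) (Y (σ i)) :=
  ciInf_le (Set.finite_range fun σ : Equiv.Perm (Fin k) => ∑ i, dist (X i) (Y (σ i))).bddBelow σ

theorem exists_confDist_eq (X Y : Fin k → Ω) :
    ∃ σ : Equiv.Perm (Fin k), ∑ i, dist (X i) (Y (σ i)) = confDist X Y :=
  exists_eq_ciInf_of_finite

theorem confDist_nonneg (X Y : Fin k → Ω) : 0 ≤ confDist X Y :=
  Real.iInf_nonneg fun _ => Finset.sum_nonneg fun _ _ => dist_nonneg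

theorem sum_dist_update (X Y : Fin k → Ω) (σ : Equiv.Perm (Fin k)) (q : Ω) (i : Fin k) :
    ∑ l, dist (Function.update X i q l) (Function.update Y (σ i) q (σ l)) + dist (X i) (Y (σ i)) =
      ∑ l, dist (X l) (Y (σ l)) := by
  rw [← Finset.add_sum_erase _ _ (Finset.mem_univ i),
    ← Finset.add_sum_erase _ (fun l => dist (X l) (Y (σ l))) (Finset.mem_univ i)]
  have h : ∀ l ∈ Finset.univ.erase i,
      dist (Function.update X i q l) (Function.update Y (σ i) q (σ l)) =
        dist (X l) (Y (σ l)) := by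
    intro l hl
    have hl := Finset.ne_of_mem_erase hl
    rw [Function.update_of_ne hl, Function.update_of_ne (σ.injective.ne hl)]
  rw [Finset.sum_congr rfl h]
  simp

end Matching

section Exchange

variable {Ω : Type*} [MetricSpace Ω] {k : ℕ}

/-- `w` is symmetric and 1-Lipschitz for the matching distance. -/
def MatchingLipschitz (w : (Fin k → Ω) → ℝ) : Prop :=
  ∀ (X Y : Fin k → Ω) (σ : Equiv.Perm (Fin k)), w Y ≤ w X + ∑ i, dist (X i) (Y (σ i))

/-- The configuration taking its points from `X` on `S` and from `Y` outside `S`. -/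
def mix (S : Finset (Fin k)) (X Y : Fin k → Ω) : Fin k → Ω :=
  fun i => if i ∈ S then X i else Y i

/-- `σ` matches `X` to `Y` in such a way that swapping any set of matched pairs does not
increase the sum of the values of `w`. -/
def ExchangeMatching (w : (Fin k → Ω) → ℝ) (X Y : Fin k → Ω) (σ : Equiv.Perm (Fin k)) : Prop :=
  ∀ S : Finset (Fin k), w (mix S X (Y ∘ σ)) + w (mix S (Y ∘ σ) X) ≤ w X + w Y

/-- Quasi-convexity in the sense of Koutsoupias and Papadimitriou. -/
def QuasiConvex (w : (Fin k → Ω) → ℝ) : Prop :=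
  ∀ X Y : Fin k → Ω, ∃ σ : Equiv.Perm (Fin k), ExchangeMatching w X Y σ

theorem MatchingLipschitz.comp_perm {w : (Fin k → Ω) → ℝ} (hw : MatchingLipschitz w)
    (X : Fin k → Ω) (τ : Equiv.Perm (Fin k)) : w (X ∘ τ) = w X := by
  apply le_antisymm
  · simpa using hw X (X ∘ τ) τ⁻¹
  · simpa using hw (X ∘ τ) X τ

/-- A common point of two configurations may be assumed to be matched to itself. -/
theorem QuasiConvex.exists_map_eq {w : (Fin k → Ω) → ℝ} (hq : QuasiConvex w)
    (hw : MatchingLipschitz w) {X Y : Fin k → Ω} {i j : Fin k} (hij : X i = Y j) :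
    ∃ σ : Equiv.Perm (Fin k), σ i = j ∧ ExchangeMatching w X Y σ := by
  obtain ⟨σ, hσ⟩ := hq X Y
  obtain ⟨i', rfl⟩ := σ.surjective j
  refine ⟨σ * Equiv.swap i i', by simp, fun S => ?_⟩
  by_cases hi : i' ∈ S
  · have e1 : mix S X (Y ∘ ⇑(σ * Equiv.swap i i')) = mix (insert i S) X (Y ∘ σ) := by
      funext l
      by_cases hl : l = i
      · subst hl; simp [mix, hij]
      · by_cases hl' : l = i'
        · subst hl'; simp [mix, hi]
        · simp [mix, hl, Equiv.swap_apply_of_ne_of_ne hl hl']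
    have e2 : mix S (Y ∘ ⇑(σ * Equiv.swap i i')) X =
        mix (insert i S) (Y ∘ σ) X ∘ Equiv.swap i i' := by
      funext l
      by_cases hl : l = i
      · subst hl; simp [mix, hi, hij]
      · by_cases hl' : l = i'
        · subst hl'; simp [mix, hi]
        · simp [mix, hl, Equiv.swap_apply_of_ne_of_ne hl hl']
    rw [e1, e2, hw.comp_perm]
    exact hσ _
  · have e1 : mix S X (Y ∘ ⇑(σ * Equiv.swap i i')) =
        mix (S.erase i) X (Y ∘ σ) ∘ Equiv.swap i i' := by
      funext l
      by_cases hl : l = i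
      · subst hl; simp [mix, hi, hij]
      · by_cases hl' : l = i'
        · subst hl'; simp [mix, hi]
        · simp [mix, hl, Equiv.swap_apply_of_ne_of_ne hl hl']
    have e2 : mix S (Y ∘ ⇑(σ * Equiv.swap i i')) X = mix (S.erase i) (Y ∘ σ) X := by
      funext l
      by_cases hl : l = i
      · subst hl; simp [mix, hij]
      · by_cases hl' : l = i'
        · subst hl'; simp [mix, hi]
        · simp [mix, hl, Equiv.swap_apply_of_ne_of_ne hl hl']
    rw [e1, e2, hw.comp_perm]
    exact hσ _

theorem matchingLipschitz_confDist (X₀ : Fin k → Ω) : MatchingLipschitz (confDist X₀) := by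
  intro X Y σ
  obtain ⟨α, hα⟩ := exists_confDist_eq X₀ X
  rw [← hα, ← Equiv.sum_comp α fun i => dist (X i) (Y (σ i)), ← Finset.sum_add_distrib]
  exact (confDist_le X₀ Y (σ * α)).trans
    (Finset.sum_le_sum fun i _ => dist_triangle _ (X (α i)) _)

theorem quasiConvex_confDist (X₀ : Fin k → Ω) : QuasiConvex (confDist X₀) := by
  intro X Y
  obtain ⟨α, hα⟩ := exists_confDist_eq X₀ X
  obtain ⟨β, hβ⟩ := exists_confDist_eq X₀ Y
  refine ⟨β * α⁻¹, fun S => ?_⟩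
  rw [← hα, ← hβ]
  refine (add_le_add (confDist_le _ _ α) (confDist_le _ _ α)).trans ?_
  rw [← Finset.sum_add_distrib, ← Finset.sum_add_distrib]
  refine Finset.sum_le_sum fun i _ => ?_
  by_cases hi : α i ∈ S
  · simp [mix, hi]
  · simp [mix, hi, add_comm]

/-- The effect on a work function of serving the request `q`. -/
noncomputable def serveStep (w : (Fin k → Ω) → ℝ) (q : Ω) (X : Fin k → Ω) : ℝ :=
  ⨅ i, (w (Function.update X i q) + dist (X i) q)

theorem serveStep_le (w : (Fin k → Ω) → ℝ) (q : Ω) (X : Fin k → Ω) (i : Fin k) :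
    serveStep w q X ≤ w (Function.update X i q) + dist (X i) q :=
  ciInf_le (Set.finite_range fun i => w (Function.update X i q) + dist (X i) q).bddBelow i

theorem exists_serveStep_eq [NeZero k] (w : (Fin k → Ω) → ℝ) (q : Ω) (X : Fin k → Ω) :
    ∃ i, w (Function.update X i q) + dist (X i) q = serveStep w q X :=
  exists_eq_ciInf_of_finite

theorem serveStep_le_self (w : (Fin k → Ω) → ℝ) {q : Ω} {X : Fin k → Ω} {i : Fin k}
    (h : X i = q) : serveStep w q X ≤ w X := by
  simpa [← h] using serveStep_le w q X i

theorem MatchingLipschitz.serveStep [NeZero k] {w : (Fin k → Ω) → ℝ}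
    (hw : MatchingLipschitz w) (q : Ω) : MatchingLipschitz (serveStep w q) := by
  intro X Y σ
  obtain ⟨i, hi⟩ := exists_serveStep_eq w q X
  have h1 := serveStep_le w q Y (σ i)
  have h2 := hw (Function.update X i q) (Function.update Y (σ i) q) σ
  have h3 := sum_dist_update X Y σ q i
  have h4 := dist_triangle_left (Y (σ i)) q (X i)
  linarith

theorem QuasiConvex.serveStep [NeZero k] {w : (Fin k → Ω) → ℝ} (hq : QuasiConvex w)
    (hw : MatchingLipschitz w) (q : Ω) : QuasiConvex (serveStep w q) := by
  intro X Y
  obtain ⟨i, hi⟩ := exists_serveStep_eq w q X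
  obtain ⟨j, hj⟩ := exists_serveStep_eq w q Y
  obtain ⟨σ, rfl, hσ⟩ := hq.exists_map_eq hw
    (X := Function.update X i q) (Y := Function.update Y j q) (i := i) (j := j) (by simp)
  have e : Function.update Y (σ i) q ∘ σ = Function.update (Y ∘ σ) i q := by
    simpa using Function.update_comp_equiv Y σ (σ i) q
  have hmix : ∀ (S : Finset (Fin k)) (A B : Fin k → Ω),
      mix S (Function.update A i q) (Function.update B i q) =
        Function.update (mix S A B) i q := by
    intro S A B
    funext l
    by_cases hl : l = i
    · subst hl; simp [mix]
    · simp [mix, hl]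
  refine ⟨σ, fun S => ?_⟩
  have h := hσ S
  rw [e, hmix, hmix] at h
  have h1 := serveStep_le w q (mix S X (Y ∘ σ)) i
  have h2 := serveStep_le w q (mix S (Y ∘ σ) X) i
  have h3 : dist (mix S X (Y ∘ σ) i) q + dist (mix S (Y ∘ σ) X i) q =
      dist (X i) q + dist (Y (σ i)) q := by
    by_cases hS : i ∈ S
    · simp [mix, hS]
    · simp [mix, hS, add_comm]
  linarith

end Exchange

section WorkFunction

variable {Ω : Type*} [MetricSpace Ω] {k : ℕ}

/-- The work function, computed recursively. -/
noncomputable def recWorkFn (X₀ : Fin k → Ω) (r : ℕ → Ω) : ℕ → (Fin k → Ω) → ℝ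
  | 0 => confDist X₀
  | t + 1 => serveStep (recWorkFn X₀ r t) (r (t + 1))

theorem matchingLipschitz_recWorkFn [NeZero k] (X₀ : Fin k → Ω) (r : ℕ → Ω) (t : ℕ) :
    MatchingLipschitz (recWorkFn X₀ r t) := by
  induction t with
  | zero => exact matchingLipschitz_confDist X₀
  | succ t ih => exact ih.serveStep _

theorem quasiConvex_recWorkFn [NeZero k] (X₀ : Fin k → Ω) (r : ℕ → Ω) (t : ℕ) :
    QuasiConvex (recWorkFn X₀ r t) := by
  induction t with
  | zero => exact quasiConvex_confDist X₀
  | succ t ih => exact ih.serveStep (matchingLipschitz_recWorkFn X₀ r t) _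

theorem recWorkFn_le_add_confDist [NeZero k] (X₀ : Fin k → Ω) (r : ℕ → Ω) (t : ℕ)
    (X Y : Fin k → Ω) : recWorkFn X₀ r t Y ≤ recWorkFn X₀ r t X + confDist X Y := by
  obtain ⟨σ, hσ⟩ := exists_confDist_eq X Y
  rw [← hσ]
  exact matchingLipschitz_recWorkFn X₀ r t X Y σ

theorem recWorkFn_le_cost [NeZero k] (X₀ : Fin k → Ω) (r : ℕ → Ω) (t : ℕ)
    (Y : ℕ → Fin k → Ω) (h0 : Y 0 = X₀) (hY : ∀ i ∈ Finset.Icc 1 t, ∃ j, Y i j = r i) :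
    recWorkFn X₀ r t (Y t) ≤ ∑ i ∈ Finset.Icc 1 t, confDist (Y (i - 1)) (Y i) := by
  induction t with
  | zero => simpa [recWorkFn, h0] using confDist_le X₀ X₀ 1
  | succ t ih =>
    obtain ⟨j, hj⟩ := hY (t + 1) (by simp)
    have h1 := ih fun i hi => hY i (Finset.Icc_subset_Icc_right (Nat.le_succ t) hi)
    have h2 : recWorkFn X₀ r (t + 1) (Y (t + 1)) ≤ recWorkFn X₀ r t (Y (t + 1)) :=
      serveStep_le_self _ hj
    have h3 := recWorkFn_le_add_confDist X₀ r t (Y t) (Y (t + 1))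
    rw [Finset.sum_Icc_succ_top (by omega)]
    simp only [Nat.add_sub_cancel]
    linarith

theorem exists_cost_le_recWorkFn [NeZero k] (X₀ : Fin k → Ω) (r : ℕ → Ω) (t : ℕ)
    (X : Fin k → Ω) : ∃ Y : ℕ → Fin k → Ω, Y 0 = X₀ ∧
      (∀ i ∈ Finset.Icc 1 t, ∃ j, Y i j = r i) ∧
      (∑ i ∈ Finset.Icc 1 t, confDist (Y (i - 1)) (Y i)) + confDist (Y t) X ≤
        recWorkFn X₀ r t X := by
  induction t generalizing X with
  | zero => exact ⟨fun _ => X₀, rfl, by simp, by simp [recWorkFn]⟩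
  | succ t ih =>
    obtain ⟨i, hi⟩ := exists_serveStep_eq (recWorkFn X₀ r t) (r (t + 1)) X
    set Z := Function.update X i (r (t + 1)) with hZ
    obtain ⟨Y, h0, hY, hc⟩ := ih Z
    have hne : ∀ l ∈ Finset.Icc 1 t, l ≠ t + 1 ∧ l - 1 ≠ t + 1 := by
      intro l hl
      rw [Finset.mem_Icc] at hl
      omega
    refine ⟨Function.update Y (t + 1) Z, by simp [h0], fun l hl => ?_, ?_⟩
    · by_cases hlt : l = t + 1
      · subst hlt
        exact ⟨i, by simp [hZ]⟩
      · rw [Function.update_of_ne hlt]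
        rw [Finset.mem_Icc] at hl
        exact hY l (Finset.mem_Icc.2 ⟨hl.1, by omega⟩)
    · rw [Finset.sum_Icc_succ_top (by omega)]
      have e : ∑ l ∈ Finset.Icc 1 t, confDist (Function.update Y (t + 1) Z (l - 1))
          (Function.update Y (t + 1) Z l) = ∑ l ∈ Finset.Icc 1 t, confDist (Y (l - 1)) (Y l) :=
        Finset.sum_congr rfl fun l hl => by
          rw [Function.update_of_ne (hne l hl).1, Function.update_of_ne (hne l hl).2]
      have hd : confDist Z X ≤ dist (X i) (r (t + 1)) := by
        refine (confDist_le Z X 1).trans_eq ?_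
        rw [Finset.sum_eq_single i]
        · simp [hZ, dist_comm]
        · intro l _ hl
          simp [hZ, hl]
        · simp
      rw [e, Nat.add_sub_cancel, Function.update_self, Function.update_of_ne (by omega)]
      change _ ≤ serveStep _ _ _
      linarith

theorem workFn_eq_recWorkFn [NeZero k] (X₀ : Fin k → Ω) (r : ℕ → Ω) (t : ℕ) :
    workFn k X₀ r t = recWorkFn X₀ r t := by
  funext X
  apply le_antisymm
  · obtain ⟨Y, h0, hY, hc⟩ := exists_cost_le_recWorkFn X₀ r t X
    refine le_trans (csInf_le ⟨0, ?_⟩ ⟨Y, h0, hY, rfl⟩) hc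
    rintro _ ⟨Y, -, -, rfl⟩
    exact add_nonneg (Finset.sum_nonneg fun _ _ => confDist_nonneg _ _) (confDist_nonneg _ _)
  · obtain ⟨Y, h0, hY, -⟩ := exists_cost_le_recWorkFn X₀ r t X
    refine le_csInf ⟨_, Y, h0, hY, rfl⟩ ?_
    rintro _ ⟨Y, h0, hY, rfl⟩
    have h1 := recWorkFn_le_cost X₀ r t Y h0 hY
    have h2 := recWorkFn_le_add_confDist X₀ r t (Y t) X
    linarith

end WorkFunction

theorem update_vec_zero {α : Type*} (a b c q : α) :
    Function.update ![a, b, c] 0 q = ![q, b, c] := by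
  funext i
  fin_cases i <;> rfl

theorem update_vec_one {α : Type*} (a b c q : α) :
    Function.update ![a, b, c] 1 q = ![a, q, c] := by
  funext i
  fin_cases i <;> rfl

section ThreeServers

variable {Ω : Type*} [MetricSpace Ω] {w : (Fin 3 → Ω) → ℝ}

theorem MatchingLipschitz.le_add_dist (hw : MatchingLipschitz w) (a b c a' b' c' : Ω) :
    w ![a', b', c'] ≤ w ![a, b, c] + (dist a a' + dist b b' + dist c c') := by
  simpa [Fin.sum_univ_three] using hw ![a, b, c] ![a', b', c'] 1

theorem MatchingLipschitz.swap_left (hw : MatchingLipschitz w) (a b c : Ω) :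
    w ![b, a, c] = w ![a, b, c] := by
  rw [← hw.comp_perm ![a, b, c] (Equiv.swap 0 1)]
  congr 1
  funext i
  fin_cases i <;> rfl

theorem MatchingLipschitz.swap_right (hw : MatchingLipschitz w) (a b c : Ω) :
    w ![a, c, b] = w ![a, b, c] := by
  rw [← hw.comp_perm ![a, b, c] (Equiv.swap 1 2)]
  congr 1
  funext i
  fin_cases i <;> rfl

/-- Four-point condition for the configurations through a fixed point `q`. -/
theorem QuasiConvex.four_point (hq : QuasiConvex w) (hw : MatchingLipschitz w)
    (q a b c d : Ω) :
    w ![q, a, d] + w ![q, b, c] ≤ w ![q, a, b] + w ![q, c, d] ∨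
      w ![q, a, c] + w ![q, b, d] ≤ w ![q, a, b] + w ![q, c, d] := by
  obtain ⟨σ, h0, hσ⟩ := hq.exists_map_eq hw (X := ![q, a, b]) (Y := ![q, c, d])
    (i := 0) (j := 0) rfl
  have h := hσ {0, 1}
  have hm : ∀ A B : Fin 3 → Ω, mix {0, 1} A B = ![A 0, A 1, B 2] := by
    intro A B
    funext i
    fin_cases i <;> simp [mix]
  have h12 : (σ 1 = 1 ∧ σ 2 = 2) ∨ (σ 1 = 2 ∧ σ 2 = 1) := by
    clear hσ h
    revert σ
    decide
  rw [hm, hm] at h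
  rcases h12 with ⟨e1, e2⟩ | ⟨e1, e2⟩
  · left
    simpa [h0, e1, e2, hw.swap_right q b c] using h
  · right
    simpa [h0, e1, e2, hw.swap_right q b d] using h

theorem QuasiConvex.two_mul_le (hq : QuasiConvex w) (hw : MatchingLipschitz w)
    (q a b c : Ω) : w ![q, a, b] + w ![q, a, c] ≤ w ![q, a, a] + w ![q, b, c] := by
  rcases hq.four_point hw q a a b c with h | h <;> linarith

theorem recWorkFn_const_ge (X₀ : Fin 3 → Ω) (r : ℕ → Ω) {t : ℕ} (ht : t ≠ 0) (a : Ω) :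
    recWorkFn X₀ r t ![r t, a, a] + dist a (r t) ≤ recWorkFn X₀ r t ![a, a, a] := by
  have hw := matchingLipschitz_recWorkFn X₀ r t
  obtain ⟨s, rfl⟩ := Nat.exists_eq_succ_of_ne_zero ht
  obtain ⟨i, hi⟩ := exists_serveStep_eq (recWorkFn X₀ r s) (r (s + 1)) ![a, a, a]
  have h : recWorkFn X₀ r (s + 1) (Function.update ![a, a, a] i (r (s + 1))) ≤
      recWorkFn X₀ r s (Function.update ![a, a, a] i (r (s + 1))) :=
    serveStep_le_self _ (i := i) (by simp)
  have e : recWorkFn X₀ r (s + 1) (Function.update ![a, a, a] i (r (s + 1))) =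
      recWorkFn X₀ r (s + 1) ![r (s + 1), a, a] := by
    rw [← hw.comp_perm _ (Equiv.swap 0 i)]
    congr 1
    funext l
    fin_cases i <;> fin_cases l <;> rfl
  have ha : ![a, a, a] i = a := by fin_cases i <;> rfl
  rw [ha] at hi
  change _ ≤ serveStep _ _ _
  change recWorkFn X₀ r (s + 1) ![r (s + 1), a, a] + _ ≤ _
  linarith

end ThreeServers

section Circle

variable {Δ : ℝ}

theorem norm_coe_of_abs_le (hΔ : 0 < Δ) {α : ℝ} (h : |α| ≤ Δ) :
    ‖(α : AddCircle (2 * Δ))‖ = |α| := by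
  rw [AddCircle.norm_coe_eq_abs_iff (2 * Δ) (by linarith), abs_of_pos (a := 2 * Δ) (by linarith)]
  linarith

theorem norm_coe_of_le_abs (hΔ : 0 < Δ) {α : ℝ} (h : Δ ≤ |α|) (h' : |α| ≤ 2 * Δ) :
    ‖(α : AddCircle (2 * Δ))‖ = 2 * Δ - |α| := by
  have hn : ‖(α : AddCircle (2 * Δ))‖ = ‖((|α| : ℝ) : AddCircle (2 * Δ))‖ := by
    rcases abs_choice α with e | e
    · rw [e]
    · rw [e, AddCircle.coe_neg, norm_neg]
  have hs : ((|α| : ℝ) : AddCircle (2 * Δ)) = ((|α| - 2 * Δ : ℝ) : AddCircle (2 * Δ)) := by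
    rw [AddCircle.coe_sub, AddCircle.coe_period, sub_zero]
  have ha : |(|α| - 2 * Δ)| = 2 * Δ - |α| := by
    rw [abs_of_nonpos (by linarith)]
    ring
  rw [hn, hs, norm_coe_of_abs_le hΔ (by linarith), ha]

theorem exists_coe_eq_abs_le (hΔ : 0 < Δ) (θ : AddCircle (2 * Δ)) :
    ∃ α : ℝ, (α : AddCircle (2 * Δ)) = θ ∧ |α| ≤ Δ := by
  have : Fact (0 < 2 * Δ) := ⟨by linarith⟩
  have hθ : θ ∈ ((↑) : ℝ → AddCircle (2 * Δ)) '' Set.Ico (-Δ) (-Δ + 2 * Δ) := by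
    rw [AddCircle.coe_image_Ico_eq]
    trivial
  obtain ⟨α, hα, rfl⟩ := hθ
  exact ⟨α, rfl, abs_le.2 ⟨hα.1, by linarith [hα.2]⟩⟩

theorem dist_antip_antip (x y : AddCircle (2 * Δ)) :
    dist (antip Δ x) (antip Δ y) = dist x y :=
  dist_add_right _ _ _

theorem antip_antip (x : AddCircle (2 * Δ)) : antip Δ (antip Δ x) = x := by
  rw [antip, antip, add_assoc, ← AddCircle.coe_add, ← two_mul, AddCircle.coe_period, add_zero]

theorem dist_antip_right (hΔ : 0 < Δ) (x y : AddCircle (2 * Δ)) :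
    dist x (antip Δ y) = Δ - dist x y := by
  obtain ⟨α, hα, h⟩ := exists_coe_eq_abs_le hΔ (y - x)
  have e : antip Δ y - x = ((α + Δ : ℝ) : AddCircle (2 * Δ)) := by
    rw [AddCircle.coe_add, hα, antip]
    abel
  rw [dist_comm, dist_comm x y, dist_eq_norm, dist_eq_norm, e, ← hα, norm_coe_of_abs_le hΔ h]
  obtain ⟨h1, h2⟩ := abs_le.1 h
  have h0 : |α + Δ| = α + Δ := abs_of_nonneg (by linarith)
  rcases le_total 0 α with hs | hs
  · rw [norm_coe_of_le_abs hΔ (by linarith) (by linarith), h0, abs_of_nonneg hs]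
    ring
  · rw [norm_coe_of_abs_le hΔ (by linarith), h0, abs_of_nonpos hs]
    ring

theorem dist_antip_left (hΔ : 0 < Δ) (x y : AddCircle (2 * Δ)) :
    dist (antip Δ x) y = Δ - dist x y := by
  rw [dist_comm, dist_antip_right hΔ, dist_comm]

/-- Of three points of a circle, either one lies between the other two or the three points
lie in no open semicircle. -/
theorem between_or_inP (hΔ : 0 < Δ) (a b c : AddCircle (2 * Δ)) :
    dist a c = dist a b + dist b c ∨ dist a b = dist a c + dist b c ∨
      dist b c = dist a b + dist a c ∨ InP Δ a b c := by
  obtain ⟨α, hα, h⟩ := exists_coe_eq_abs_le hΔ (a - b)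
  obtain ⟨β, hβ, h'⟩ := exists_coe_eq_abs_le hΔ (b - c)
  have e : a - c = ((α + β : ℝ) : AddCircle (2 * Δ)) := by
    rw [AddCircle.coe_add, hα, hβ]
    abel
  rw [InP, dist_comm c a, dist_eq_norm, dist_eq_norm, dist_eq_norm, e, ← hα, ← hβ,
    norm_coe_of_abs_le hΔ h, norm_coe_of_abs_le hΔ h']
  rcases le_total |α + β| Δ with hs | hs
  · rw [norm_coe_of_abs_le hΔ hs]
    grind
  · rw [norm_coe_of_le_abs hΔ hs (by linarith [abs_add_le α β])]
    grind

theorem norm_coe_cases (hΔ : 0 < Δ) {α : ℝ} (h : |α| ≤ 2 * Δ) :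
    (|α| ≤ Δ ∧ ‖(α : AddCircle (2 * Δ))‖ = |α|) ∨
      (Δ ≤ |α| ∧ ‖(α : AddCircle (2 * Δ))‖ = 2 * Δ - |α|) := by
  rcases le_total |α| Δ with hs | hs
  · exact Or.inl ⟨hs, norm_coe_of_abs_le hΔ hs⟩
  · exact Or.inr ⟨hs, norm_coe_of_le_abs hΔ hs h⟩

theorem InP.replace (hΔ : 0 < Δ) {x y z : AddCircle (2 * Δ)} (h : InP Δ x y z)
    (u : AddCircle (2 * Δ)) : InP Δ u y z ∨ InP Δ x u z ∨ InP Δ x y u := by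
  obtain ⟨α, hα, ha⟩ := exists_coe_eq_abs_le hΔ (x - u)
  obtain ⟨β, hβ, hb⟩ := exists_coe_eq_abs_le hΔ (y - u)
  obtain ⟨γ, hγ, hc⟩ := exists_coe_eq_abs_le hΔ (z - u)
  have e1 : x - y = ((α - β : ℝ) : AddCircle (2 * Δ)) := by
    rw [AddCircle.coe_sub, hα, hβ]
    abel
  have e2 : y - z = ((β - γ : ℝ) : AddCircle (2 * Δ)) := by
    rw [AddCircle.coe_sub, hβ, hγ]
    abel
  have e3 : x - z = ((α - γ : ℝ) : AddCircle (2 * Δ)) := by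
    rw [AddCircle.coe_sub, hα, hγ]
    abel
  rw [InP, dist_comm z x, dist_eq_norm, dist_eq_norm, dist_eq_norm, e1, e2, e3] at h
  rw [InP, InP, InP, dist_comm u y, dist_comm u z, dist_comm z x, dist_comm u x, dist_eq_norm,
    dist_eq_norm, dist_eq_norm, dist_eq_norm, dist_eq_norm, dist_eq_norm, e1, e2, e3, ← hα, ← hβ, ← hγ,
    norm_coe_of_abs_le hΔ ha, norm_coe_of_abs_le hΔ hb, norm_coe_of_abs_le hΔ hc]
  have n1 := norm_coe_cases (α := α - β) hΔ (by linarith [abs_sub α β])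
  have n2 := norm_coe_cases (α := β - γ) hΔ (by linarith [abs_sub β γ])
  have n3 := norm_coe_cases (α := α - γ) hΔ (by linarith [abs_sub α γ])
  clear e1 e2 e3 hα hβ hγ
  generalize ‖((α - β : ℝ) : AddCircle (2 * Δ))‖ = p at *
  generalize ‖((β - γ : ℝ) : AddCircle (2 * Δ))‖ = q at *
  generalize ‖((α - γ : ℝ) : AddCircle (2 * Δ))‖ = s at *
  grind (splits := 30)

theorem inP_antip (hΔ : 0 < Δ) (x y : AddCircle (2 * Δ)) : InP Δ x y (antip Δ x) := by
  have h1 := dist_antip_right hΔ y x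
  have h2 := dist_antip_left hΔ x x
  rw [dist_self] at h2
  rw [dist_comm y x] at h1
  rw [InP]
  linarith

/-- The position of a point `u` of the circle relative to points `x`, `y`, `z` in no open
semicircle: on the arc from `y` to `z` opposite to `x`, or separated from `x` by `z`, or with
the antipode of `z` between `x` and `u`, or between `z` and the antipode of `y`. -/
theorem position_cases (hΔ : 0 < Δ) {x y z : AddCircle (2 * Δ)} (h : InP Δ x y z)
    (u : AddCircle (2 * Δ)) :
    InP Δ u y z ∨ InP Δ x z u ∨ dist u x = dist u z + dist z x ∨
      (dist u y = dist u z + dist z y ∧ InP Δ u x y) := by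
  have h1 := between_or_inP hΔ u y z
  have h2 := between_or_inP hΔ u x z
  have h3 := between_or_inP hΔ u x y
  have h4 := h.replace hΔ u
  simp only [InP, dist_comm z x, dist_comm z y, dist_comm x u, dist_comm y u,
    dist_comm z u] at *
  have n1 : 0 ≤ dist u x := dist_nonneg
  have n2 : 0 ≤ dist u y := dist_nonneg
  have n3 : 0 ≤ dist u z := dist_nonneg
  have n4 : 0 ≤ dist x y := dist_nonneg
  have n5 : 0 ≤ dist x z := dist_nonneg
  have n6 : 0 ≤ dist y z := dist_nonneg
  have m1 : dist x y ≤ Δ := by linarith [dist_antip_right hΔ x y, @dist_nonneg _ _ x (antip Δ y)]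
  have m2 : dist x z ≤ Δ := by linarith [dist_antip_right hΔ x z, @dist_nonneg _ _ x (antip Δ z)]
  have m3 : dist u y ≤ Δ := by linarith [dist_antip_right hΔ u y, @dist_nonneg _ _ u (antip Δ y)]
  have m4 : dist u z ≤ Δ := by linarith [dist_antip_right hΔ u z, @dist_nonneg _ _ u (antip Δ z)]
  have m5 : dist u x ≤ Δ := by linarith [dist_antip_right hΔ u x, @dist_nonneg _ _ u (antip Δ x)]
  have m6 : dist y z ≤ Δ := by linarith [dist_antip_right hΔ y z, @dist_nonneg _ _ y (antip Δ z)]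
  grind

/-- Moving two servers of `w ![q, a, b]` to the antipode of `q`, and then the third one. -/
theorem MatchingLipschitz.antip_le (hΔ : 0 < Δ) {w : (Fin 3 → AddCircle (2 * Δ)) → ℝ}
    (hw : MatchingLipschitz w) (q a b : AddCircle (2 * Δ)) :
    w ![antip Δ q, antip Δ q, antip Δ q] ≤
      w ![q, a, b] + Δ + (Δ - dist a q) + (Δ - dist b q) := by
  have h := hw.le_add_dist q a b (antip Δ q) (antip Δ q) (antip Δ q)
  simp only [dist_antip_right hΔ, dist_self] at h
  linarith

theorem exists_phiStar_le (hΔ : 0 < Δ) {w : (Fin 3 → AddCircle (2 * Δ)) → ℝ}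
    (hw : MatchingLipschitz w) (hq : QuasiConvex w) {q u x y z : AddCircle (2 * Δ)}
    (h0 : w ![q, antip Δ u, antip Δ u] + dist (antip Δ u) q ≤
      w ![antip Δ u, antip Δ u, antip Δ u])
    (h1 : w ![u, x, antip Δ y] = w ![u, q, antip Δ y] + dist x q)
    (h2 : w ![u, y, antip Δ z] = w ![q, y, antip Δ z] + dist u q)
    (h3 : w ![u, z, antip Δ x] = w ![q, z, antip Δ x] + dist u q)
    (hP : InP Δ q y z) :
    ∃ x' y' z' : AddCircle (2 * Δ), InP Δ x' y' z' ∧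
      PhiStar Δ w q x' y' z' ≤ PhiStar Δ w u x y z := by
  rw [dist_antip_left hΔ] at h0
  rw [hw.swap_left q u] at h1
  have hxq := dist_antip_left hΔ x q
  have hzq := dist_antip_left hΔ z q
  rcases position_cases hΔ hP u with hu | hu | hu | ⟨hu, hu'⟩
  · refine ⟨u, y, z, hu, ?_⟩
    simp only [PhiStar]
    have e := hq.two_mul_le hw q (antip Δ u) z (antip Δ x)
    have l := hw.antip_le hΔ q (antip Δ u) (antip Δ x)
    rw [dist_antip_left hΔ] at l
    rw [hw.swap_right q z (antip Δ u)] at e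
    linarith
  · refine ⟨u, y, antip Δ u, inP_antip hΔ u y, ?_⟩
    simp only [PhiStar, antip_antip]
    have l := hw.antip_le hΔ q z (antip Δ x)
    have m := hw.le_add_dist q y (antip Δ z) q y u
    simp only [dist_antip_left hΔ, dist_self, dist_comm z u] at m
    rw [InP, dist_comm z u] at hu
    rw [dist_comm q z] at hu
    linarith
  · refine ⟨u, y, antip Δ u, inP_antip hΔ u y, ?_⟩
    simp only [PhiStar, antip_antip]
    have m := hw.le_add_dist q z (antip Δ x) q u (antip Δ x)
    simp only [dist_self, dist_comm z u] at m
    have s := hw.swap_right q u y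
    rcases hq.four_point hw q y (antip Δ z) u (antip Δ x) with h | h
    · have l := hw.antip_le hΔ q y (antip Δ x)
      have m' := hw.le_add_dist q (antip Δ z) u q y u
      have s' := hw.swap_right q (antip Δ z) u
      simp only [dist_self, dist_antip_left hΔ] at m'
      rw [InP, dist_comm q y, dist_comm y z] at hP
      linarith
    · have l := hw.antip_le hΔ q (antip Δ z) (antip Δ x)
      linarith
  · have e := hq.two_mul_le hw q (antip Δ u) y (antip Δ z)
    rw [InP, dist_comm y u] at hu'
    rcases hq.four_point hw q (antip Δ u) y z (antip Δ x) with h | h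
    · have l := hw.antip_le hΔ q (antip Δ u) (antip Δ x)
      have s1 := hw.swap_right q y z
      have s2 := hw.swap_right q u (antip Δ y)
      refine ⟨z, antip Δ y, antip Δ u, ?_, ?_⟩
      · rw [InP, dist_antip_antip, dist_antip_left hΔ, dist_antip_right hΔ, dist_comm y u]
        linarith
      · simp only [PhiStar, antip_antip]
        rw [dist_antip_left hΔ] at l
        linarith
    · have l := hw.antip_le hΔ q y (antip Δ x)
      have m := hw.le_add_dist q u (antip Δ y) q u u
      have s := hw.swap_right q z (antip Δ u)
      simp only [dist_self, dist_antip_left hΔ] at m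
      have c1 := dist_comm y u
      have c2 := dist_comm q y
      refine ⟨u, antip Δ u, z, ?_, ?_⟩
      · rw [InP, dist_antip_left hΔ, dist_antip_right hΔ, dist_self, dist_comm z u]
        ring
      · simp only [PhiStar, antip_antip]
        linarith

end Circle

/-- Subcase 2a: if `w(u x ȳ)` resolves from `x`, both `w(u y z̄)` and `w(u z x̄)` resolve
from `u`, and `r` lies on the arc between `ȳ` and `z̄` not containing `x̄`, then there is
`(x',y',z') ∈ P` with `Φ*(w,u,x,y,z) ≥ Φ*(w,r,x',y',z')`. -/
theorem phiStar_subcase_2a (Δ : ℝ) (hΔ : 0 < Δ)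
    (X₀ : Fin 3 → AddCircle (2*Δ)) (r : ℕ → AddCircle (2*Δ)) (T t : ℕ)
    (ht : 1 ≤ t) (htT : t ≤ T) (u x y z : AddCircle (2*Δ)) (hP : InP Δ x y z)
    (h1 : ResolvesFrom (workFn 3 X₀ r t) (r t) ![u, x, antip Δ y] 1)
    (h2 : ResolvesFrom (workFn 3 X₀ r t) (r t) ![u, y, antip Δ z] 0)
    (h3 : ResolvesFrom (workFn 3 X₀ r t) (r t) ![u, z, antip Δ x] 0)
    (harc : dist (antip Δ y) (r t) + dist (r t) (antip Δ z) =
      dist (antip Δ y) (antip Δ z)) :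
    ∃ x' y' z' : AddCircle (2*Δ), InP Δ x' y' z' ∧
      PhiStar Δ (workFn 3 X₀ r t) (r t) x' y' z' ≤
        PhiStar Δ (workFn 3 X₀ r t) u x y z := by
  rw [workFn_eq_recWorkFn] at h1 h2 h3 ⊢
  rw [ResolvesFrom, update_vec_one] at h1
  rw [ResolvesFrom, update_vec_zero] at h2 h3
  have hP' : InP Δ (r t) y z := by
    simp only [dist_antip_left hΔ, dist_antip_right hΔ] at harc
    rw [dist_comm y (r t), dist_comm (r t) z] at harc
    rw [InP]
    linarith
  exact exists_phiStar_le hΔ (matchingLipschitz_recWorkFn X₀ r t)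
    (quasiConvex_recWorkFn X₀ r t)
    (recWorkFn_const_ge X₀ r (Nat.one_le_iff_ne_zero.1 ht) _) h1 h2 h3 hP'
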